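/- arXiv:2001.04836 — 2 statements merged into one kernel-verified Lean document; each statement's English description precedes it below -/
import Mathlib

section
/- Every connected, locally Hamiltonian simple graph on n ≥ 3 vertices has at least 3n − 6 edges. -/
/-- A simple graph `G` is locally Hamiltonian if for every vertex `v` of degree `d`,
there is a cyclic ordering `v₁, …, v_d` of the neighbours of `v` (equivalently, of the
edges incident with `v`) such that `v_i` and `v_{i+1}` are adjacent in `G` for every `i`
(indices modulo `d`) whenever `v_i` and `v_{i+1}` are distinct. -/
def SimpleGraph.LocallyHamiltonian {V : Type*} [Fintype V] [DecidableEq V]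
    (G : SimpleGraph V) [DecidableRel G.Adj] : Prop :=
  ∀ v : V, ∃ e : Fin (G.degree v) ≃ (G.neighborFinset v),
    ∀ i : Fin (G.degree v),
      (e i : V) ≠ (e (finRotate _ i) : V) → G.Adj (e i) (e (finRotate _ i))

namespace LHam

open Finset

variable {V : Type*} [Fintype V] [DecidableEq V] (G : SimpleGraph V) [DecidableRel G.Adj]

/-- A system of cyclic orders of the neighbourhoods. -/
structure Rot (σ : V → Equiv.Perm V) : Prop where
  nbr : ∀ v x, G.Adj v x → G.Adj v (σ v x)
  adj : ∀ v x, G.Adj v x → σ v x ≠ x → G.Adj x (σ v x)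
  cyc : ∀ v (P : V → Prop), (∀ x, G.Adj v x → P x → P (σ v x)) →
    ∀ x y, G.Adj v x → G.Adj v y → P x → P y

theorem rotate_reach {n : ℕ} (P : Fin n → Prop) (h : ∀ i, P i → P (finRotate n i))
    (i j : Fin n) (hi : P i) : P j := by
  cases n with
  | zero => exact i.elim0
  | succ n =>
    have key : ∀ k : ℕ, P (i + Fin.ofNat (n+1) k) := by
      intro k
      induction k with
      | zero => simpa using hi
      | succ k ih =>
        have := h _ ih
        rw [finRotate_apply] at this
        convert this using 1
        rw [add_assoc]
        congr 1
        ext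
        simp [Fin.val_add]
    have := key (j - i).val
    simpa using this

theorem exists_rot (h : G.LocallyHamiltonian) : ∃ σ, Rot G σ := by
  choose e he using h
  let τ : ∀ v, Equiv.Perm (G.neighborFinset v) := fun v =>
    ((e v).symm.trans (finRotate _)).trans (e v)
  have hτ : ∀ v (x : V) (hx : x ∈ G.neighborFinset v),
      Equiv.Perm.ofSubtype (τ v) x = (e v (finRotate _ ((e v).symm ⟨x, hx⟩)) : V) := by
    intro v x hx
    rw [Equiv.Perm.ofSubtype_apply_of_mem (τ v) hx]
    rfl
  refine ⟨fun v => Equiv.Perm.ofSubtype (τ v), ?_, ?_, ?_⟩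
  · intro v x hx
    have hx' : x ∈ G.neighborFinset v := by simpa using hx
    rw [hτ v x hx']
    exact (G.mem_neighborFinset _ _).1 (e v (finRotate _ ((e v).symm ⟨x, hx'⟩))).2
  · intro v x hx hne
    have hx' : x ∈ G.neighborFinset v := by simpa using hx
    rw [hτ v x hx'] at hne ⊢
    have := he v ((e v).symm ⟨x, hx'⟩)
    simp only [Equiv.apply_symm_apply] at this
    exact this hne.symm
  · intro v P hP x y hx hy hPx
    have hx' : x ∈ G.neighborFinset v := by simpa using hx
    have hy' : y ∈ G.neighborFinset v := by simpa using hy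
    have := rotate_reach (fun i => P (e v i)) (fun i hi => by
      have h1 := hP (e v i) ((G.mem_neighborFinset _ _).1 (e v i).2) hi
      rw [hτ v _ (e v i).2] at h1
      simpa using h1) ((e v).symm ⟨x, hx'⟩) ((e v).symm ⟨y, hy'⟩) (by simpa using hPx)
    simpa using this

/-- degree inside `C` -/
def dg (C : Finset V) (w : V) : ℕ := #{x ∈ C | G.Adj w x}

/-- number of `C`-runs in the cyclic order at `w` -/
def rn (σ : V → Equiv.Perm V) (C : Finset V) (w : V) : ℕ :=
  #{x | G.Adj w x ∧ x ∉ C ∧ σ w x ∈ C}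

/-- twice the potential -/
def Phi (σ : V → Equiv.Perm V) (C : Finset V) : ℕ := ∑ w ∈ C, (dg G C w + 2 * rn G σ C w)

def aOut (σ : V → Equiv.Perm V) (C : Finset V) (v : V) : ℕ :=
  #{w ∈ C | G.Adj w v ∧ σ w v ∉ C}

def aIn (σ : V → Equiv.Perm V) (C : Finset V) (v : V) : ℕ :=
  #{w ∈ C | G.Adj w v ∧ (σ w).symm v ∉ C}

variable {G} {σ : V → Equiv.Perm V}

theorem Rot.nbr_symm (hr : Rot G σ) {v x : V} (h : G.Adj v x) : G.Adj v ((σ v).symm x) := by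
  by_contra hc
  -- the restriction to the neighbourhood is injective, hence surjective
  have hmap : Set.MapsTo (σ v) (G.neighborFinset v : Set V) (G.neighborFinset v : Set V) := by
    intro y hy
    simpa using hr.nbr v y (by simpa using hy)
  have := Finset.surjOn_of_injOn_of_card_le (σ v) hmap ((σ v).injective.injOn) le_rfl
  obtain ⟨y, hy, hyx⟩ := this (show x ∈ (G.neighborFinset v : Set V) by simpa using h)
  apply hc
  rw [← hyx]
  simpa using hy

theorem rn_step (hr : Rot G σ) (C : Finset V) (v w : V) (hv : v ∈ C) :
    rn G σ (C.erase v) w + (if G.Adj w v ∧ σ w v ∉ C then 1 else 0)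
      + (if G.Adj w v ∧ (σ w).symm v ∉ C then 1 else 0)
      ≤ rn G σ C w + (if G.Adj w v then 1 else 0) := by
  unfold rn
  set A : Finset V := {x | G.Adj w x ∧ x ∉ C ∧ σ w x ∈ C} with hA
  set A' : Finset V := {x | G.Adj w x ∧ x ∉ C.erase v ∧ σ w x ∈ C.erase v} with hA'
  by_cases hwv : G.Adj w v
  · simp only [hwv, true_and, if_true]
    set p := (σ w).symm v with hp
    have hpv : σ w p = v := by simp [hp]
    have hwp : G.Adj w p := hr.nbr_symm hwv
    have hpA' : p ∉ A' := by simp [hA', hpv]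
    have hsub : A' ⊆ insert v A := by
      intro x hx
      simp only [hA', hA, mem_filter, mem_univ, true_and, mem_erase, mem_insert] at hx ⊢
      tauto
    have hα : σ w v ∉ C → v ∉ A' := by
      intro h
      simp [hA', h]
    have hβ : p ∉ C → p ∈ A := by
      intro h
      simp [hA, hwp, h, hpv, hv]
    have hvA : v ∉ A := by simp [hA, hv]
    have h1 : σ w v ∉ C → A' ⊆ A := fun h => (subset_insert_iff_of_notMem (hα h)).1 hsub
    by_cases a : σ w v ∈ C <;> by_cases b : p ∈ C <;> simp only [a, b, not_true, not_false_iff, if_true, if_false]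
    · have := card_le_card hsub
      rw [card_insert_of_notMem hvA] at this
      omega
    · have : A' ⊆ (insert v A).erase p := fun x hx =>
        mem_erase.2 ⟨fun h => hpA' (h ▸ hx), hsub hx⟩
      have := card_le_card this
      rw [card_erase_of_mem (mem_insert_of_mem (hβ b)), card_insert_of_notMem hvA] at this
      omega
    · have := card_le_card (h1 a)
      omega
    · have : A' ⊆ A.erase p := fun x hx =>
        mem_erase.2 ⟨fun h => hpA' (h ▸ hx), h1 a hx⟩
      have := card_lt_card (lt_of_le_of_lt this (erase_ssubset (hβ b)))
      omega
  · simp only [hwv, false_and, if_false]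
    have : A' ⊆ A := by
      intro x hx
      simp only [hA', hA, mem_filter, mem_univ, true_and, mem_erase] at hx ⊢
      have : x ≠ v := fun h => hwv (h ▸ hx.1)
      tauto
    have := card_le_card this
    omega

theorem dg_step (C : Finset V) (v w : V) (hv : v ∈ C) :
    dg G C w = dg G (C.erase v) w + (if G.Adj w v then 1 else 0) := by
  unfold dg
  rw [filter_erase]
  split_ifs with h
  · rw [card_erase_add_one]
    simp [hv, h]
  · rw [erase_eq_of_notMem]
    · rfl
    · simp [h]

theorem Phi_step (hr : Rot G σ) (C : Finset V) (v : V) (hv : v ∈ C) :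
    Phi G σ (C.erase v) + 2 * (rn G σ C v + aOut G σ C v + aIn G σ C v) ≤ Phi G σ C := by
  have e1 : Phi G σ C = (dg G C v + 2 * rn G σ C v)
      + ∑ w ∈ C.erase v, (dg G C w + 2 * rn G σ C w) := by
    unfold Phi
    exact (add_sum_erase C (fun w => dg G C w + 2 * rn G σ C w) hv).symm
  have e2 : aOut G σ C v = ∑ w ∈ C.erase v, (if G.Adj w v ∧ σ w v ∉ C then 1 else 0) := by
    unfold aOut
    rw [card_filter, ← add_sum_erase _ _ hv]
    simp
  have e3 : aIn G σ C v = ∑ w ∈ C.erase v, (if G.Adj w v ∧ (σ w).symm v ∉ C then 1 else 0) := by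
    unfold aIn
    rw [card_filter, ← add_sum_erase _ _ hv]
    simp
  have e4 : dg G C v = ∑ w ∈ C.erase v, (if G.Adj w v then 1 else 0) := by
    unfold dg
    rw [card_filter, ← add_sum_erase _ _ hv]
    simp [G.adj_comm]
  have e5 : Phi G σ (C.erase v) + 2 * aOut G σ C v + 2 * aIn G σ C v
      ≤ dg G C v + ∑ w ∈ C.erase v, (dg G C w + 2 * rn G σ C w) := by
    rw [e2, e3, e4]
    unfold Phi
    simp only [mul_sum, ← sum_add_distrib]
    apply sum_le_sum
    intro w _
    have h1 := rn_step hr C v w hv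
    have h2 := dg_step (G := G) C v w hv
    omega
  omega

theorem sum_a (hr : Rot G σ) (C : Finset V) :
    ∑ v ∈ C, (aOut G σ C v + aIn G σ C v) = 2 * ∑ v ∈ C, rn G σ C v := by
  have h1 : ∑ v ∈ C, aIn G σ C v = ∑ w ∈ C, rn G σ C w := by
    unfold aIn
    simp only [card_filter]
    rw [sum_comm]
    apply sum_congr rfl
    intro w _
    rw [← card_filter]
    unfold rn
    apply card_bij' (fun x _ => (σ w).symm x) (fun x _ => σ w x)
    · intro x hx
      simp only [mem_filter, mem_univ, true_and] at hx ⊢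
      exact ⟨hr.nbr_symm hx.2.1, hx.2.2, by simpa using hx.1⟩
    · intro x hx
      simp only [mem_filter, mem_univ, true_and] at hx ⊢
      exact ⟨hx.2.2, hr.nbr _ _ hx.1, by simpa using hx.2.1⟩
    · simp
    · simp
  have h2 : ∑ v ∈ C, aOut G σ C v = ∑ w ∈ C, rn G σ C w := by
    unfold aOut
    simp only [card_filter]
    rw [sum_comm]
    apply sum_congr rfl
    intro w _
    rw [← card_filter]
    unfold rn
    -- entries into `C` equal exits from `C`
    set N := G.neighborFinset w with hN
    have hx1 : #{x ∈ N | x ∈ C} = #{x ∈ N | σ w x ∈ C} := by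
      apply card_bij' (fun x _ => (σ w).symm x) (fun x _ => σ w x)
      · intro x hx
        simp only [hN, mem_filter, SimpleGraph.mem_neighborFinset] at hx ⊢
        exact ⟨hr.nbr_symm hx.1, by simpa using hx.2⟩
      · intro x hx
        simp only [hN, mem_filter, SimpleGraph.mem_neighborFinset] at hx ⊢
        exact ⟨hr.nbr _ _ hx.1, hx.2⟩
      · simp
      · simp
    have hx2 := card_filter_add_card_filter_not (s := {x ∈ N | x ∈ C}) (fun x => σ w x ∈ C)
    have hx3 := card_filter_add_card_filter_not (s := {x ∈ N | σ w x ∈ C}) (fun x => x ∈ C)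
    rw [filter_filter, filter_filter] at hx2 hx3
    have hx4 : ({x ∈ N | x ∈ C ∧ σ w x ∈ C} : Finset V) = {x ∈ N | σ w x ∈ C ∧ x ∈ C} := by
      ext x; simp [and_comm]
    have hx5 : ({x ∈ C | G.Adj w x ∧ σ w x ∉ C} : Finset V) = {x ∈ N | x ∈ C ∧ σ w x ∉ C} := by
      ext x; simp [hN]; tauto
    have hx6 : ({x | G.Adj w x ∧ x ∉ C ∧ σ w x ∈ C} : Finset V)
        = {x ∈ N | σ w x ∈ C ∧ x ∉ C} := by
      ext x; simp [hN]; tauto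
    rw [hx5, hx6]
    rw [hx4] at hx2
    omega
  rw [sum_add_distrib, h1, h2]
  ring

theorem all_of_rn_zero (hr : Rot G σ) {C : Finset V} {w : V} (h : rn G σ C w = 0)
    {x y : V} (hx : G.Adj w x) (hy : G.Adj w y) (hxC : x ∈ C) : y ∈ C := by
  by_contra hyC
  have h' : ∀ z, G.Adj w z → z ∉ C → σ w z ∉ C := by
    intro z hz hzC hc
    unfold rn at h
    rw [card_eq_zero] at h
    have : z ∈ ({x | G.Adj w x ∧ x ∉ C ∧ σ w x ∈ C} : Finset V) := by simp [hz, hzC, hc]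
    rw [h] at this
    simp at this
  exact hr.cyc w (fun z => z ∉ C) h' y x hy hx hyC hxC

theorem a_zero (hr : Rot G σ) {C : Finset V} {v : V} (hv : v ∈ C) (h : rn G σ C v = 0) :
    aOut G σ C v + aIn G σ C v = 0 := by
  have h1 : aOut G σ C v = 0 := by
    unfold aOut
    rw [card_eq_zero, filter_eq_empty_iff]
    rintro w hw ⟨hwv, hc⟩
    have hh : σ w v ≠ v := fun e => hc (by rw [e]; exact hv)
    exact hc (all_of_rn_zero hr h hwv.symm (hr.adj w v hwv hh) hw)
  have h2 : aIn G σ C v = 0 := by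
    unfold aIn
    rw [card_eq_zero, filter_eq_empty_iff]
    rintro w hw ⟨hwv, hc⟩
    have hh : σ w ((σ w).symm v) ≠ (σ w).symm v := by
      intro e
      apply hc
      rw [← e, Equiv.apply_symm_apply]
      exact hv
    have h3 := hr.adj w _ (hr.nbr_symm hwv) hh
    rw [Equiv.apply_symm_apply] at h3
    exact hc (all_of_rn_zero hr h hwv.symm h3.symm hw)
  omega

/-- Every nonempty union of components of `G[C]` meets `R`. -/
def Hits (G : SimpleGraph V) (C R : Finset V) : Prop :=
  ∀ D ⊆ C, D.Nonempty → (∀ x ∈ D, ∀ y ∈ C, G.Adj x y → y ∈ D) → ∃ ρ ∈ R, ρ ∈ D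

theorem Hits.move {C R : Finset V} (h : Hits G C R) {v : V} (hv : v ∈ C) :
    ∃ R', Hits G C R' ∧ v ∈ R' ∧ #R' ≤ #R := by
  classical
  let Dv : Finset V := C.filter (fun y => ∀ D ⊆ C,
    (∀ x ∈ D, ∀ y ∈ C, G.Adj x y → y ∈ D) → v ∈ D → y ∈ D)
  obtain ⟨ρ, hρ, hρD⟩ := h Dv (filter_subset _ _) ⟨v, by simp [Dv, hv]⟩ (by
    intro x hx y hy hxy
    simp only [Dv, mem_filter] at hx ⊢
    exact ⟨hy, fun D hD hcl hvD => hcl x (hx.2 D hD hcl hvD) y hy hxy⟩)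
  refine ⟨insert v (R.erase ρ), ?_, mem_insert_self _ _, ?_⟩
  · intro D hD hne hcl
    obtain ⟨ρ', hρ', hρD'⟩ := h D hD hne hcl
    by_cases e : ρ' = ρ
    · subst e
      refine ⟨v, mem_insert_self _ _, ?_⟩
      by_contra hvD
      simp only [Dv, mem_filter] at hρD
      have := hρD.2 (C \ D) sdiff_subset (by
        intro x hx y hy hxy
        simp only [mem_sdiff] at hx ⊢
        exact ⟨hy, fun hyD => hx.2 (hcl y hyD x hx.1 hxy.symm)⟩) (by simp [hv, hvD])
      simp [hρD'] at this
    · exact ⟨ρ', by simp [e, hρ'], hρD'⟩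
  · have := card_insert_le v (R.erase ρ)
    rw [card_erase_of_mem hρ] at this
    have := card_pos.2 ⟨ρ, hρ⟩
    omega

theorem Hits.remove (hr : Rot G σ) {C R : Finset V} (h : Hits G C R) {v : V}
    (hR : v ∈ R) (hrn : 1 ≤ rn G σ C v) :
    ∃ R', Hits G (C.erase v) R' ∧ #R' + 1 ≤ #R + rn G σ C v := by
  let A : Finset V := {x | G.Adj v x ∧ x ∉ C ∧ σ v x ∈ C}
  refine ⟨R.erase v ∪ A.image (σ v), ?_, ?_⟩
  · intro D hD hne hcl
    by_cases hx : ∃ x ∈ D, G.Adj v x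
    · obtain ⟨x, hxD, hvx⟩ := hx
      by_contra hcon
      push Not at hcon
      obtain ⟨z, hz⟩ := card_pos.1 hrn
      simp only [mem_filter, mem_univ, true_and] at hz
      have hDC : ∀ y ∈ D, y ∈ C := fun y hy => (mem_erase.1 (hD hy)).2
      refine hr.cyc v (fun y => y ∉ D) ?_ z x hz.1 hvx (fun hzD => hz.2.1 (hDC z hzD)) hxD
      intro y hvy hyD hs
      by_cases hyC : y ∈ C
      · by_cases e : σ v y = y
        · exact hyD (e ▸ hs)
        · exact hyD (hcl _ hs y (mem_erase.2 ⟨hvy.ne', hyC⟩) (hr.adj v y hvy e).symm)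
      · refine hcon (σ v y) (mem_union_right _ (mem_image_of_mem _ ?_)) hs
        simp [A, hvy, hyC, hDC _ hs]
    · push Not at hx
      obtain ⟨ρ, hρ, hρD⟩ := h D (hD.trans (erase_subset _ _)) hne (by
        intro x hxD y hy hxy
        refine hcl x hxD y (mem_erase.2 ⟨?_, hy⟩) hxy
        rintro rfl
        exact hx x hxD hxy.symm)
      exact ⟨ρ, mem_union_left _ (mem_erase.2 ⟨(mem_erase.1 (hD hρD)).1, hρ⟩), hρD⟩
  · have h1 := card_union_le (R.erase v) (A.image (σ v))
    have h2 : #(A.image (σ v)) ≤ rn G σ C v := card_image_le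
    have h3 := card_erase_add_one hR
    omega

theorem eq_univ_of_closed (hc : G.Connected) (D : Finset V) (hne : D.Nonempty)
    (hcl : ∀ x ∈ D, ∀ y, G.Adj x y → y ∈ D) (y : V) : y ∈ D := by
  obtain ⟨x, hx⟩ := hne
  obtain ⟨p⟩ := hc.preconnected x y
  induction p with
  | nil => exact hx
  | cons h p ih => exact ih (hcl _ hx _ h)

theorem main (hc : G.Connected) (hr : Rot G σ) : ∀ (n : ℕ) (C R : Finset V), #C = n →
    C ≠ univ → Hits G C R → 6 * #C ≤ Phi G σ C + 6 * #R := by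
  intro n
  induction n with
  | zero =>
    intro C R hC _ _
    omega
  | succ n ih =>
    intro C R hC hCu hR
    by_cases hex : ∃ v ∈ C, 1 ≤ rn G σ C v
    · obtain ⟨v, hv, hrv, hav⟩ : ∃ v ∈ C, 1 ≤ rn G σ C v ∧
          2 * rn G σ C v ≤ aOut G σ C v + aIn G σ C v := by
        by_contra hcon
        push Not at hcon
        have hs := sum_a hr C
        rw [mul_sum] at hs
        refine absurd hs (ne_of_lt (sum_lt_sum ?_ ?_))
        · intro v hv
          by_cases h0 : 1 ≤ rn G σ C v
          · exact (hcon v hv h0).le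
          · rw [a_zero hr hv (by omega)]
            exact Nat.zero_le _
        · obtain ⟨v, hv, h1⟩ := hex
          exact ⟨v, hv, hcon v hv h1⟩
      obtain ⟨R1, hR1, hvR1, hc1⟩ := hR.move hv
      obtain ⟨R2, hR2, hc2⟩ := hR1.remove hr hvR1 hrv
      have hce := card_erase_add_one hv
      have h1 := ih (C.erase v) R2 (by omega) (fun e => by
        have := mem_univ v
        rw [← e] at this
        simp at this) hR2
      have h2 := Phi_step hr C v hv
      omega
    · push Not at hex
      have hiso : ∀ x ∈ C, ∀ y ∈ C, ¬ G.Adj x y := by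
        intro x hx y hy hxy
        apply hCu
        rw [eq_univ_iff_forall]
        intro z
        have := eq_univ_of_closed hc ({a ∈ C | ∃ b ∈ C, G.Adj a b} : Finset V)
          ⟨x, by simp only [mem_filter]; exact ⟨hx, y, hy, hxy⟩⟩ (by
            intro a ha b hab
            simp only [mem_filter] at ha ⊢
            obtain ⟨haC, c, hcC, hac⟩ := ha
            have h0 : rn G σ C a = 0 := by
              have := hex a haC
              omega
            exact ⟨all_of_rn_zero hr h0 hac hab hcC, a, haC, hab.symm⟩) z
        exact (mem_filter.1 this).1
      have : C ⊆ R := by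
        intro x hx
        obtain ⟨ρ, hρ, hρx⟩ := hR {x} (by simpa using hx) (by simp) (by
          intro a ha y hy hay
          rw [mem_singleton] at ha
          subst ha
          exact absurd hay (hiso a hx y hy))
        rw [mem_singleton] at hρx
        exact hρx ▸ hρ
      have := card_le_card this
      omega

theorem final (hc : G.Connected) (hr : Rot G σ) (hn : 3 ≤ Fintype.card V) :
    3 * Fintype.card V - 6 ≤ #G.edgeFinset := by
  obtain ⟨v⟩ := hc.nonempty
  obtain ⟨x, hvx⟩ : ∃ x, G.Adj v x := by
    by_contra hcon
    push Not at hcon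
    have h1 := eq_univ_of_closed hc {v} (by simp) (by
      intro x hx y hxy
      rw [mem_singleton] at hx
      subst hx
      exact absurd hxy (hcon y))
    have h2 : (univ : Finset V) ⊆ {v} := fun y _ => h1 y
    have := card_le_card h2
    simp at this
    omega
  have hits : Hits G (univ.erase v) {x} := by
    intro D hD hne hcl
    refine ⟨x, mem_singleton_self _, ?_⟩
    have hvD : v ∉ D := fun h => by simpa using hD h
    obtain ⟨y, hyD, hvy⟩ : ∃ y ∈ D, G.Adj v y := by
      by_contra hcon
      push Not at hcon
      refine hvD (eq_univ_of_closed hc D hne ?_ v)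
      intro a ha b hab
      refine hcl a ha b (mem_erase.2 ⟨?_, mem_univ _⟩) hab
      rintro rfl
      exact hcon a ha hab.symm
    refine hr.cyc v (fun z => z ∈ D) ?_ y x hvy hvx hyD
    intro z hvz hzD
    by_cases e : σ v z = z
    · rwa [e]
    · exact hcl z hzD _ (mem_erase.2 ⟨(hr.nbr v z hvz).ne', mem_univ _⟩) (hr.adj v z hvz e)
  have hm := main hc hr _ (univ.erase v) {x} rfl (fun e => by
    have := mem_univ v
    rw [← e] at this
    simp at this) hits
  have hcard : #(univ.erase v) + 1 = Fintype.card V := card_erase_add_one (mem_univ v)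
  have hPhi : Phi G σ (univ.erase v) ≤ 2 * #G.edgeFinset := by
    rw [← G.sum_degrees_eq_twice_card_edges, ← add_sum_erase _ _ (mem_univ v)]
    have hd : G.degree v = ∑ w ∈ univ.erase v, (if G.Adj w v then 1 else 0) := by
      rw [← card_filter, ← G.card_neighborFinset_eq_degree]
      congr 1
      ext w
      simp only [SimpleGraph.mem_neighborFinset, mem_filter, mem_erase, mem_univ, and_true]
      exact ⟨fun h => ⟨h.ne', h.symm⟩, fun h => h.2.symm⟩
    rw [hd, ← sum_add_distrib]
    unfold Phi
    apply sum_le_sum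
    intro w _
    have h1 := dg_step (G := G) univ v w (mem_univ v)
    have h2 : dg G univ w = G.degree w := by
      unfold dg
      rw [← G.card_neighborFinset_eq_degree]
      congr 1
      ext y
      simp
    have h3 : rn G σ (univ.erase v) w ≤ if G.Adj w v then 1 else 0 := by
      unfold rn
      split_ifs with h
      · rw [card_le_one]
        intro a ha b hb
        simp at ha hb
        rw [ha.2.1, hb.2.1]
      · rw [Nat.le_zero, card_eq_zero, filter_eq_empty_iff]
        rintro y _ ⟨hy, hyv, _⟩
        simp at hyv
        exact h (hyv ▸ hy)
    omega
  rw [card_singleton] at hm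
  omega

end LHam

/-- Every connected, locally Hamiltonian simple graph on `n ≥ 3` vertices has at least
`3n − 6` edges. -/
theorem locallyHamiltonian_three_n_sub_six_le_card_edges
    {V : Type*} [Fintype V] [DecidableEq V] (G : SimpleGraph V) [DecidableRel G.Adj]
    (hconn : G.Connected) (hlh : G.LocallyHamiltonian)
    (hn : 3 ≤ Fintype.card V) :
    3 * Fintype.card V - 6 ≤ G.edgeFinset.card := by
  obtain ⟨σ, hr⟩ := LHam.exists_rot G hlh
  exact LHam.final hconn hr hn
end

section
/- If G is a connected, locally Hamiltonian simple graph on n ≥ 3 vertices with at most 3n − 6 edges, then G has exactly 3n − 6 edges. -/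
namespace LH
def nb {d : ℕ} (vs : List (Fin d)) (L : List (Fin d × Fin d)) (a : Fin d) : List (Fin d) :=
  vs.filter fun z => L.elem (a, z) || L.elem (z, a)

def chainB {d : ℕ} (R : Fin d → Fin d → Bool) : List (Fin d) → Bool
  | [] => true
  | a :: l => (match l with | [] => true | b :: _ => R a b) && chainB R l

def Rp {d : ℕ} (R : Fin d → Fin d → Bool) (L : List (Fin d × Fin d)) (a b : Fin d) : Bool :=
  R a b || L.elem (a, b) || L.elem (b, a)

def good {d : ℕ} (vs : List (Fin d)) (R : Fin d → Fin d → Bool) (L : List (Fin d × Fin d))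
    (a x y : Fin d) : Bool :=
  chainB (Rp R L) (y :: (nb vs L a ++ [x])) || chainB (Rp R L) (y :: ((nb vs L a).reverse ++ [x]))

def valid {d : ℕ} (R : Fin d → Fin d → Bool) (a x y : Fin d) : Bool :=
  !(x == y) && R a x && R a y

def okL {d : ℕ} (R : Fin d → Fin d → Bool) (L : List (Fin d × Fin d)) : Bool :=
  L.all fun p => !(p.1 == p.2) && !(R p.1 p.2)

def chk {d : ℕ} (vs : List (Fin d)) (cands : List (List (Fin d × Fin d)))
    (R : Fin d → Fin d → Bool) : Bool :=
  vs.any fun k => vs.all fun x => vs.all fun y => !(valid R k x y) ||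
    cands.any fun L => okL R L && good vs R L k x y &&
      vs.all fun a => a == k || vs.all fun x' => vs.all fun y' => !(valid R a x' y') ||
        good vs R L a x' y'

def tbl5 (c0 c1 c2 c3 c4 : Bool) (i j : Fin 5) : Bool :=
  match i, j with
  | 0, 1 | 1, 0 | 1, 2 | 2, 1 | 2, 3 | 3, 2 | 3, 4 | 4, 3 | 4, 0 | 0, 4 => true
  | 0, 2 | 2, 0 => c0
  | 1, 3 | 3, 1 => c1
  | 2, 4 | 4, 2 => c2
  | 3, 0 | 0, 3 => c3
  | 4, 1 | 1, 4 => c4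
  | _, _ => false

def tbl4 (c0 c1 : Bool) (i j : Fin 4) : Bool :=
  match i, j with
  | 0, 1 | 1, 0 | 1, 2 | 2, 1 | 2, 3 | 3, 2 | 3, 0 | 0, 3 => true
  | 0, 2 | 2, 0 => c0
  | 1, 3 | 3, 1 => c1
  | _, _ => false

def cands5 : List (List (Fin 5 × Fin 5)) :=
  [[], [(0,2)], [(1,3)], [(2,4)], [(3,0)], [(4,1)],
   [(0,2),(1,3)], [(0,2),(2,4)], [(0,2),(3,0)], [(0,2),(4,1)],
   [(1,3),(2,4)], [(1,3),(3,0)], [(1,3),(4,1)], [(2,4),(3,0)], [(2,4),(4,1)], [(3,0),(4,1)]]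

set_option maxRecDepth 100000 in
theorem chk5 : ∀ c0 c1 c2 c3 c4 : Bool, chk [0,1,2,3,4] cands5 (tbl5 c0 c1 c2 c3 c4) = true := by
  decide +kernel

theorem chk4 : ∀ c0 c1 : Bool, chk [0,1,2,3] [[], [(0,2)], [(1,3)]] (tbl4 c0 c1) = true := by
  decide +kernel

theorem chk3 : chk [0,1,2] [[]] (fun i j : Fin 3 => !(i == j)) = true := by
  decide +kernel

theorem chainB_iff {d : ℕ} (R : Fin d → Fin d → Bool) (l : List (Fin d)) (h : chainB R l = true) :
    l.IsChain (fun a b => R a b = true) := by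
  induction l with
  | nil => simp
  | cons a l ih =>
    cases l with
    | nil => simp
    | cons b l =>
      simp only [chainB, Bool.and_eq_true] at h ih
      simp only [List.isChain_cons_cons]
      exact ⟨h.1, ih (by simpa using h.2)⟩

theorem mem_nb {d : ℕ} (vs : List (Fin d)) (hv : ∀ i, i ∈ vs) (L : List (Fin d × Fin d)) (a z) :
    z ∈ nb vs L a ↔ (a, z) ∈ L ∨ (z, a) ∈ L := by
  simp [nb, hv]

theorem good_spec {d : ℕ} (vs : List (Fin d)) (hv : ∀ i, i ∈ vs) (hnd : vs.Nodup)
    (R : Fin d → Fin d → Bool) (L : List (Fin d × Fin d))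
    (a x y : Fin d) (h : good vs R L a x y = true) :
    ∃ q : List (Fin d), q.Nodup ∧ (∀ z, z ∈ q ↔ ((a, z) ∈ L ∨ (z, a) ∈ L)) ∧
      (y :: (q ++ [x])).IsChain (fun a b => R a b = true ∨ (a, b) ∈ L ∨ (b, a) ∈ L) := by
  have key : ∀ l, chainB (Rp R L) l = true →
      l.IsChain (fun a b => R a b = true ∨ (a, b) ∈ L ∨ (b, a) ∈ L) := by
    intro l hl
    refine (chainB_iff _ l hl).imp ?_
    intro a b h
    simpa [Rp, or_assoc] using h
  have hn : (nb vs L a).Nodup := hnd.filter _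
  simp only [good, Bool.or_eq_true] at h
  rcases h with h | h
  · exact ⟨_, hn, mem_nb vs hv L a, key _ h⟩
  · exact ⟨_, List.nodup_reverse.2 hn, by simpa using mem_nb vs hv L a, key _ h⟩

/-- The conclusion of the finite local problem. -/
def Loc (d : ℕ) (R : Fin d → Fin d → Bool) : Prop :=
  ∀ x y : Fin d → Fin d, (∀ a, x a ≠ y a ∧ R a (x a) = true ∧ R a (y a) = true) →
    ∃ L : List (Fin d × Fin d), L.length + 3 ≤ d ∧ (∀ p ∈ L, p.1 ≠ p.2 ∧ R p.1 p.2 = false) ∧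
      ∀ a, ∃ q : List (Fin d), q.Nodup ∧ (∀ z, z ∈ q ↔ ((a, z) ∈ L ∨ (z, a) ∈ L)) ∧
      (y a :: (q ++ [x a])).IsChain (fun a b => R a b = true ∨ (a, b) ∈ L ∨ (b, a) ∈ L)

theorem chk_spec {d : ℕ} (vs : List (Fin d)) (hv : ∀ i, i ∈ vs) (hnd : vs.Nodup)
    (cands : List (List (Fin d × Fin d))) (hc : ∀ L ∈ cands, L.length + 3 ≤ d)
    (R : Fin d → Fin d → Bool) (h : chk vs cands R = true) : Loc d R := by
  intro x y hxy
  have hval : ∀ a, valid R a (x a) (y a) = true := by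
    intro a; simp [valid, hxy a]
  simp only [chk, List.any_eq_true, List.all_eq_true] at h
  obtain ⟨k, -, hk⟩ := h
  have := hk (x k) (hv _) (y k) (hv _)
  simp only [hval, Bool.not_true, Bool.false_or, List.any_eq_true, Bool.and_eq_true,
    List.all_eq_true] at this
  obtain ⟨L, hL, ⟨h1, h2⟩, h3⟩ := this
  refine ⟨L, hc L hL, ?_, ?_⟩
  · intro p hp
    simp only [okL, List.all_eq_true] at h1
    simpa using h1 p hp
  · intro a
    apply good_spec vs hv hnd
    by_cases ha : a = k
    · subst ha; exact h2
    · have := h3 a (hv a)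
      simp only [ha, beq_iff_eq, Bool.or_eq_true, List.all_eq_true, false_or] at this
      have := this (x a) (hv _) (y a) (hv _)
      simpa [hval] using this

theorem loc5 (R : Fin 5 → Fin 5 → Bool) (hs : ∀ i j, R i j = R j i) (hi : ∀ i, R i i = false)
    (hc : ∀ i, R i (i + 1) = true) : Loc 5 R := by
  have : R = tbl5 (R 0 2) (R 1 3) (R 2 4) (R 3 0) (R 4 1) := by
    funext i j
    have h0 := hc 0
    have h1 := hc 1
    have h2 := hc 2
    have h3 := hc 3
    have h4 := hc 4
    simp at h0 h1 h2 h3 h4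
    fin_cases i <;> fin_cases j <;> simp [tbl5, hi] <;> first | assumption | (rw [hs]; assumption) | (rw [hs])
  rw [this]
  exact chk_spec [0,1,2,3,4] (by decide) (by decide) cands5 (by decide) _ (chk5 _ _ _ _ _)

theorem loc4 (R : Fin 4 → Fin 4 → Bool) (hs : ∀ i j, R i j = R j i) (hi : ∀ i, R i i = false)
    (hc : ∀ i, R i (i + 1) = true) : Loc 4 R := by
  have : R = tbl4 (R 0 2) (R 1 3) := by
    funext i j
    have h0 := hc 0
    have h1 := hc 1
    have h2 := hc 2
    have h3 := hc 3
    simp at h0 h1 h2 h3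
    fin_cases i <;> fin_cases j <;> simp [tbl4, hi] <;> first | assumption | (rw [hs]; assumption) | (rw [hs])
  rw [this]
  exact chk_spec [0,1,2,3] (by decide) (by decide) _ (by decide) _ (chk4 _ _)

theorem loc3 (R : Fin 3 → Fin 3 → Bool) (hs : ∀ i j, R i j = R j i) (hi : ∀ i, R i i = false)
    (hc : ∀ i, R i (i + 1) = true) : Loc 3 R := by
  have : R = (fun i j : Fin 3 => !(i == j)) := by
    funext i j
    have h0 := hc 0
    have h1 := hc 1
    have h2 := hc 2
    simp at h0 h1 h2
    fin_cases i <;> fin_cases j <;> simp [hi] <;> first | assumption | (rw [hs]; assumption)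
  rw [this]
  exact chk_spec [0,1,2] (by decide) (by decide) _ (by decide) _ chk3


variable {V : Type*}

def Ham (G : SimpleGraph V) (v : V) : Prop :=
  ∃ b l, (b :: l).Nodup ∧ (∀ x, x ∈ b :: l ↔ G.Adj v x) ∧ (b :: (l ++ [b])).IsChain G.Adj

theorem ham_rotate {G : SimpleGraph V} {v a : V} (h : Ham G v) (ha : G.Adj v a) :
    ∃ l, (a :: l).Nodup ∧ (∀ x, x ∈ a :: l ↔ G.Adj v x) ∧ (a :: (l ++ [a])).IsChain G.Adj := by
  obtain ⟨b, l, hnd, hm, hc⟩ := h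
  have := (hm a).2 ha
  rcases List.mem_cons.1 this with rfl | h
  · exact ⟨l, hnd, hm, hc⟩
  · obtain ⟨s, t, rfl⟩ := List.append_of_mem h
    have hp : (b :: (s ++ a :: t)).Perm (a :: (t ++ b :: s)) := by
      have : (b :: s ++ a :: t).Perm (a :: t ++ b :: s) := List.perm_append_comm
      simpa using this
    refine ⟨t ++ b :: s, hp.nodup_iff.1 hnd, fun x => by rw [← hp.mem_iff, hm], ?_⟩
    have e1 : b :: (s ++ a :: t ++ [b]) = (b :: s) ++ a :: (t ++ [b]) := by simp
    have e2 : a :: (t ++ b :: s ++ [a]) = (a :: t) ++ b :: (s ++ [a]) := by simp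
    rw [e1, List.isChain_split] at hc
    rw [e2, List.isChain_split]
    simpa using hc.symm

structure Inv (S : Finset V) (G : SimpleGraph V) : Prop where
  supp : ∀ x y, G.Adj x y → x ∈ S
  conn : ∀ P : V → Prop, (∃ s ∈ S, P s) → (∀ x y, G.Adj x y → P x → P y) → ∀ s ∈ S, P s
  ham : ∀ x ∈ S, Ham G x

theorem chain_closed {G : SimpleGraph V} {P : V → Prop} {a : V} {l : List V}
    (hc : (a :: l).IsChain G.Adj) (hP : ∀ x ∈ a :: l, ∀ y ∈ a :: l, G.Adj x y → P x → P y)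
    (ha : P a) : ∀ x ∈ a :: l, P x := by
  induction l generalizing a with
  | nil => simpa using ha
  | cons b l ih =>
    rw [List.isChain_cons_cons] at hc
    have hb : P b := hP a (by simp) b (by simp) hc.1 ha
    intro x hx
    rcases List.mem_cons.1 hx with rfl | hx
    · exact ha
    · exact ih hc.2 (fun x hx y hy => hP x (by simp at hx ⊢; tauto) y (by simp at hy ⊢; tauto)) hb x hx

/-- path form -/
theorem ham_path {G : SimpleGraph V} {a v : V} (h : Ham G a) (hv : G.Adj a v) :
    (∃ b, (∀ z, G.Adj a z ↔ z = v ∨ z = b) ∧ G.Adj v b) ∨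
    ∃ x y m, (v :: x :: (m ++ [y])).Nodup ∧ (∀ z, z ∈ v :: x :: (m ++ [y]) ↔ G.Adj a z) ∧
      (x :: (m ++ [y])).IsChain G.Adj ∧ G.Adj v x ∧ G.Adj v y := by
  obtain ⟨l, hnd, hm, hc⟩ := ham_rotate h hv
  cases l with
  | nil => simp at hc
  | cons x l =>
    rcases List.eq_nil_or_concat l with rfl | ⟨m, y, rfl⟩
    · left
      refine ⟨x, fun z => by rw [← hm]; simp, ?_⟩
      simpa [G.adj_comm] using hc
    · right
      simp only [List.concat_eq_append] at *
      refine ⟨x, y, m, hnd, hm, ?_, ?_⟩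
      · rw [List.cons_append, List.isChain_cons_cons] at hc
        have := hc.2
        rw [← List.cons_append] at this
        exact this.left_of_append
      · have e : v :: (x :: (m ++ [y]) ++ [v]) = (v :: x :: m) ++ y :: [v] := by simp
        constructor
        · rw [List.cons_append, List.isChain_cons_cons] at hc
          exact hc.1
        · rw [e, List.isChain_split] at hc
          simpa [G.adj_comm] using hc.2

/-- A vertex whose neighbourhood is a pair forces a triangle. -/
theorem triangle {S : Finset V} {G : SimpleGraph V} (hI : Inv S G) {v a b : V} (hv : v ∈ S)
    (hN : ∀ z, G.Adj v z ↔ z = a ∨ z = b) (hab : G.Adj a b) : S.card ≤ 3 := by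
  classical
  have key : ∀ a b : V, (∀ z, G.Adj v z ↔ z = a ∨ z = b) → 
      ∀ z, G.Adj a z → z = v ∨ z = b := by
    intro a b hN z hz
    have hva : G.Adj a v := ((hN a).2 (Or.inl rfl)).symm
    rcases ham_path (hI.ham a (hI.supp _ _ hz)) hva with ⟨c, hc, hvc⟩ | ⟨x, y, m, hnd, hm, -, hx, hy⟩
    · rcases (hc z).1 hz with h | rfl
      · exact Or.inl h
      · rcases (hN z).1 hvc with rfl | h
        · exact absurd rfl hz.ne
        · exact Or.inr h
    · exfalso
      have hax : G.Adj a x := (hm x).1 (by simp)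
      have hay : G.Adj a y := (hm y).1 (by simp)
      have h1 : x = b := ((hN x).1 hx).resolve_left hax.ne'
      have h2 : y = b := ((hN y).1 hy).resolve_left hay.ne'
      subst h1 h2
      simp at hnd
  have hsub : S ⊆ {v, a, b} := by
    intro s hs
    have := hI.conn (fun z => z = v ∨ z = a ∨ z = b) ⟨v, hv, Or.inl rfl⟩ ?_ s hs
    · simpa using this
    · rintro x y hxy (rfl | rfl | rfl)
      · exact Or.inr ((hN y).1 hxy)
      · rcases key x b hN y hxy with h | h <;> simp [h]
      · rcases key x a (fun z => by rw [hN, or_comm]) y hxy with h | h <;> simp [h]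
  exact (Finset.card_le_card hsub).trans Finset.card_le_three

theorem ham_path' {S : Finset V} {G : SimpleGraph V} (hI : Inv S G) (hS : 4 ≤ S.card) {a v : V}
    (hv : G.Adj a v) :
    ∃ x y m, (v :: x :: (m ++ [y])).Nodup ∧ (∀ z, z ∈ v :: x :: (m ++ [y]) ↔ G.Adj a z) ∧
      (x :: (m ++ [y])).IsChain G.Adj ∧ G.Adj v x ∧ G.Adj v y := by
  rcases ham_path (hI.ham a (hI.supp _ _ hv)) hv with ⟨b, hb, hvb⟩ | h
  · have := triangle hI (hI.supp _ _ hv) hb hvb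
    omega
  · exact h

/-- delete `v`, add the chords -/
def red (G : SimpleGraph V) (v : V) {d : ℕ} (f : Fin d → V) (L : List (Fin d × Fin d)) :
    SimpleGraph V where
  Adj x y := (G.Adj x y ∧ x ≠ v ∧ y ≠ v) ∨
    (∃ i j, x = f i ∧ y = f j ∧ i ≠ j ∧ f i ≠ f j ∧ ((i, j) ∈ L ∨ (j, i) ∈ L))
  symm := ⟨by
    rintro x y (⟨h, h1, h2⟩ | ⟨i, j, hx, hy, hij, hf, h⟩)
    · exact Or.inl ⟨h.symm, h2, h1⟩
    · exact Or.inr ⟨j, i, hy, hx, hij.symm, hf.symm, h.symm⟩⟩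
  loopless := ⟨by
    rintro x (⟨h, -⟩ | ⟨i, j, hx, hy, hij, hf, h⟩)
    · exact h.ne rfl
    · exact hf (hx ▸ hy)⟩

theorem red_edges [Fintype V] (G : SimpleGraph V) (v : V) {d : ℕ} (f : Fin d → V)
    (hf : Function.Injective f) (hfv : ∀ z, G.Adj v z ↔ ∃ i, z = f i)
    (L : List (Fin d × Fin d)) (hL : L.length + 3 ≤ d) :
    (red G v f L).edgeSet.ncard + 3 ≤ G.edgeSet.ncard := by
  classical
  have hA : (Set.range fun i => s(v, f i)) ⊆ G.edgeSet := by
    rintro _ ⟨i, rfl⟩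
    simp only [SimpleGraph.mem_edgeSet]
    exact (hfv _).2 ⟨i, rfl⟩
  have hAc : (Set.range fun i => s(v, f i)).ncard = d := by
    rw [← Set.image_univ, Set.ncard_image_of_injective]
    · simp [Set.ncard_univ]
    · intro i j h
      have := Sym2.congr_right.1 h
      exact hf this
  have hsub : (red G v f L).edgeSet ⊆ (G.edgeSet \ Set.range fun i => s(v, f i)) ∪
      ((L.map fun p => s(f p.1, f p.2)).toFinset : Set (Sym2 V)) := by
    intro e
    induction e using Sym2.ind with
    | _ x y =>
    rintro (⟨h, h1, h2⟩ | ⟨i, j, rfl, rfl, hij, hf, h⟩)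
    · left
      refine ⟨h, ?_⟩
      rintro ⟨i, hi⟩
      rcases Sym2.eq_iff.1 hi with h | h
      · exact h1 h.1.symm
      · exact h2 h.1.symm
    · right
      simp only [List.coe_toFinset, List.mem_map, Set.mem_ofPred_eq]
      rcases h with h | h
      · exact ⟨_, h, rfl⟩
      · exact ⟨_, h, Sym2.eq_swap⟩
  have h1 := Set.ncard_le_ncard hsub (Set.toFinite _)
  have h2 := Set.ncard_union_le (G.edgeSet \ Set.range fun i => s(v, f i))
      ((L.map fun p => s(f p.1, f p.2)).toFinset : Set (Sym2 V))
  have h3 := Set.ncard_sdiff hA (Set.toFinite _)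
  have h4 := Set.ncard_le_ncard hA (Set.toFinite _)
  have h5 : ((L.map fun p => s(f p.1, f p.2)).toFinset : Set (Sym2 V)).ncard ≤ L.length := by
    rw [Set.ncard_coe_finset]
    exact (List.toFinset_card_le _).trans (by simp)
  omega

theorem red_inv [DecidableEq V] {S : Finset V} {G : SimpleGraph V} (hI : Inv S G)
    (hS : 4 ≤ S.card) (v : V) (hv : v ∈ S) {d : ℕ} (f : Fin d → V)
    (hf : Function.Injective f) (hfv : ∀ z, G.Adj v z ↔ ∃ i, z = f i)
    (R : Fin d → Fin d → Bool) (hR : ∀ i j, R i j = true ↔ G.Adj (f i) (f j)) (hloc : Loc d R) :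
    ∃ L : List (Fin d × Fin d), L.length + 3 ≤ d ∧ Inv (S.erase v) (red G v f L) := by
  have hvf : ∀ i, G.Adj v (f i) := fun i => (hfv _).2 ⟨i, rfl⟩
  have hp : ∀ i, ∃ x y m, (v :: f x :: (m ++ [f y])).Nodup ∧
      (∀ z, z ∈ v :: f x :: (m ++ [f y]) ↔ G.Adj (f i) z) ∧
      (f x :: (m ++ [f y])).IsChain G.Adj := by
    intro i
    obtain ⟨x, y, m, h1, h2, h3, h4, h5⟩ := ham_path' hI hS (hvf i).symm
    obtain ⟨x, rfl⟩ := (hfv _).1 h4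
    obtain ⟨y, rfl⟩ := (hfv _).1 h5
    exact ⟨x, y, m, h1, h2, h3⟩
  choose x y m hnd hm hc using hp
  obtain ⟨L, hL, hL2, hq⟩ := hloc x y (by
    intro a
    refine ⟨?_, ?_, ?_⟩
    · intro h
      have := hnd a
      simp [h] at this
    · rw [hR, ← hm a]; simp
    · rw [hR, ← hm a]; simp)
  refine ⟨L, hL, ?_⟩
  have hsym : ∀ i j, R i j = R j i := by
    intro i j
    rw [Bool.eq_iff_iff, hR, hR, G.adj_comm]
  have hL3 : ∀ i j, ((i, j) ∈ L ∨ (j, i) ∈ L) → i ≠ j ∧ ¬ G.Adj (f i) (f j) := by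
    rintro i j (h | h)
    · obtain ⟨h1, h2⟩ := hL2 _ h
      refine ⟨h1, ?_⟩
      rw [← hR]; simp_all
    · obtain ⟨h1, h2⟩ := hL2 _ h
      refine ⟨h1.symm, ?_⟩
      rw [← hR, hsym]; simp_all
  have hlr : ∀ i j, ((i, j) ∈ L ∨ (j, i) ∈ L) → (red G v f L).Adj (f i) (f j) := by
    intro i j h
    exact Or.inr ⟨i, j, rfl, rfl, (hL3 i j h).1, hf.ne (hL3 i j h).1, h⟩
  have hfne : ∀ i, f i ≠ v := fun i => (hvf i).ne'
  have chain_red : ∀ l : List V, l.IsChain G.Adj → v ∉ l → l.IsChain (red G v f L).Adj := by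
    intro l h hl
    refine h.imp_of_mem_imp ?_
    intro a b ha hb hab
    exact Or.inl ⟨hab, fun h => hl (h ▸ ha), fun h => hl (h ▸ hb)⟩
  refine ⟨?_, ?_, ?_⟩
  · rintro a b (⟨h, h1, h2⟩ | ⟨i, j, rfl, rfl, -⟩)
    · exact Finset.mem_erase.2 ⟨h1, hI.supp _ _ h⟩
    · exact Finset.mem_erase.2 ⟨hfne i, hI.supp _ _ (hvf i).symm⟩
  · rintro P ⟨s, hs, hPs⟩ hP t ht
    rw [Finset.mem_erase] at hs ht
    by_cases hN : ∃ i, P (f i)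
    · obtain ⟨i, hi⟩ := hN
      have hall : ∀ j, P (f j) := by
        intro j
        obtain ⟨l, h1, h2, h3⟩ := ham_rotate (hI.ham v hv) (hvf i)
        have hvl : v ∉ f i :: (l ++ [f i]) := by
          intro h
          have : v ∈ f i :: l := by simp at h ⊢; tauto
          exact ((h2 v).1 this).ne rfl
        have := chain_closed (chain_red _ h3 hvl) (fun a _ b _ => hP a b) hi
        apply this
        have := (h2 (f j)).2 (hvf j)
        simp at this ⊢; tauto
      have := hI.conn (fun z => z = v ∨ P z) ⟨s, hs.2, Or.inr hPs⟩ ?_ t ht.2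
      · exact this.resolve_left ht.1
      · intro a b hab ha
        by_cases hb : b = v
        · exact Or.inl hb
        right
        by_cases hav : a = v
        · subst hav
          obtain ⟨j, rfl⟩ := (hfv b).1 hab
          exact hall j
        · exact hP a b (Or.inl ⟨hab, hav, hb⟩) (ha.resolve_left hav)
    · have := hI.conn (fun z => z ≠ v ∧ P z) ⟨s, hs.2, hs.1, hPs⟩ ?_ t ht.2
      · exact this.2
      · rintro a b hab ⟨hav, ha⟩
        have hb : b ≠ v := by
          rintro rfl
          obtain ⟨i, rfl⟩ := (hfv a).1 hab.symm
          exact hN ⟨i, ha⟩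
        exact ⟨hb, hP a b (Or.inl ⟨hab, hav, hb⟩) ha⟩
  · intro a ha
    rw [Finset.mem_erase] at ha
    by_cases hva : G.Adj v a
    · obtain ⟨i, rfl⟩ := (hfv a).1 hva
      obtain ⟨q, hq1, hq2, hq3⟩ := hq i
      have hnd' := hnd i
      have hmi := hm i
      rw [List.nodup_cons] at hnd'
      have hqm : ∀ z, z ∈ q.map f → ¬ G.Adj (f i) z := by
        intro z hz
        obtain ⟨j, hj, rfl⟩ := List.mem_map.1 hz
        exact (hL3 i j ((hq2 j).1 hj)).2
      refine ⟨f (x i), (m i ++ [f (y i)]) ++ q.map f, ?_, ?_, ?_⟩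
      · rw [← List.cons_append]
        refine List.Nodup.append hnd'.2 (hq1.map hf) ?_
        intro z hz hz2
        exact hqm z hz2 ((hmi z).1 (List.mem_cons_of_mem _ hz))
      · intro z
        rw [← List.cons_append, List.mem_append]
        constructor
        · rintro (h | h)
          · refine Or.inl ⟨(hmi z).1 (List.mem_cons_of_mem _ h), hfne i, ?_⟩
            rintro rfl
            exact hnd'.1 h
          · obtain ⟨j, hj, rfl⟩ := List.mem_map.1 h
            exact hlr i j ((hq2 j).1 hj)
        · rintro (⟨h, h1, h2⟩ | ⟨i', j, h1, rfl, -, -, h⟩)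
          · exact Or.inl ((List.mem_cons.1 ((hmi z).2 h)).resolve_left h2)
          · obtain rfl := hf h1
            exact Or.inr (List.mem_map.2 ⟨j, (hq2 j).2 h, rfl⟩)
      · have e : f (x i) :: (m i ++ [f (y i)] ++ q.map f ++ [f (x i)]) =
            (f (x i) :: m i) ++ f (y i) :: (q.map f ++ [f (x i)]) := by simp
        rw [e, List.isChain_split]
        constructor
        · exact chain_red _ (hc i) hnd'.1
        · have e2 : f (y i) :: (q.map f ++ [f (x i)]) = (y i :: (q ++ [x i])).map f := by simp
          rw [e2, List.isChain_map]
          refine hq3.imp ?_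
          rintro a b (h | h)
          · exact Or.inl ⟨(hR _ _).1 h, hfne _, hfne _⟩
          · exact hlr a b h
    · obtain ⟨b, l, h1, h2, h3⟩ := hI.ham a ha.2
      have hvl : v ∉ b :: l := fun h => hva ((h2 v).1 h).symm
      refine ⟨b, l, h1, ?_, chain_red _ h3 (by simp at hvl ⊢; tauto)⟩
      intro z
      rw [h2]
      constructor
      · intro h
        exact Or.inl ⟨h, ha.1, by rintro rfl; exact hva h.symm⟩
      · rintro (h | ⟨i, j, rfl, -⟩)
        · exact h.1
        · exact absurd (hvf i) hva

theorem loc_of_ham {G : SimpleGraph V} {v : V} {b : V} {l : List V} (h1 : (b :: l).Nodup)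
    (h2 : ∀ x, x ∈ b :: l ↔ G.Adj v x) (h3 : (b :: (l ++ [b])).IsChain G.Adj)
    (hl : 2 ≤ l.length) (hl' : l.length ≤ 4) :
    ∃ (d : ℕ) (f : Fin d → V) (R : Fin d → Fin d → Bool), Function.Injective f ∧
      (∀ z, G.Adj v z ↔ ∃ i, z = f i) ∧ (∀ i j, R i j = true ↔ G.Adj (f i) (f j)) ∧ Loc d R := by
  classical
  refine ⟨(b :: l).length, (b :: l).get, fun i j => decide (G.Adj ((b :: l).get i) ((b :: l).get j)),
    List.nodup_iff_injective_get.1 h1, ?_, by simp, ?_⟩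
  · intro z
    rw [← h2, List.mem_iff_get]
    simp [eq_comm]
  · match l, hl, hl' with
    | [a1, a2], _, _ =>
      apply loc3
      · simp [G.adj_comm]
      · simp
      · simp at h3
        intro i; fin_cases i <;> simp [h3]
    | [a1, a2, a3], _, _ =>
      apply loc4
      · simp [G.adj_comm]
      · simp
      · simp at h3
        intro i; fin_cases i <;> simp [h3]
    | [a1, a2, a3, a4], _, _ =>
      apply loc5
      · simp [G.adj_comm]
      · simp
      · simp at h3
        intro i; fin_cases i <;> simp [h3]

theorem edges_of_degree [Fintype V] {S : Finset V} {G : SimpleGraph V} (k : ℕ)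
    (h : ∀ v ∈ S, ∃ l : List V, l.Nodup ∧ (∀ x, x ∈ l ↔ G.Adj v x) ∧ k ≤ l.length) :
    S.card * k ≤ 2 * G.edgeSet.ncard := by
  classical
  have e := G.sum_degrees_eq_twice_card_edges
  rw [Set.ncard_eq_toFinset_card' G.edgeSet]
  have e3 : G.edgeSet.toFinset = G.edgeFinset := rfl
  rw [e3, ← e]
  calc S.card * k = ∑ v ∈ S, k := by simp
    _ ≤ ∑ v ∈ S, G.degree v := by
      apply Finset.sum_le_sum
      intro v hv
      obtain ⟨l, h1, h2, h3⟩ := h v hv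
      rw [← List.toFinset_card_of_nodup h1] at h3
      refine h3.trans (le_of_eq ?_)
      unfold SimpleGraph.degree
      congr 1
      ext x; simp [h2]
    _ ≤ _ := Finset.sum_le_sum_of_subset (Finset.subset_univ _)

theorem main [Fintype V] (n : ℕ) : ∀ (S : Finset V) (G : SimpleGraph V), Inv S G → S.card = n + 3 →
    3 * (n + 3) ≤ G.edgeSet.ncard + 6 := by
  classical
  induction n with
  | zero =>
    intro S G hI hS
    have := edges_of_degree (S := S) (G := G) 2 (by
      intro v hv
      obtain ⟨b, l, h1, h2, h3⟩ := hI.ham v hv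
      refine ⟨b :: l, h1, h2, ?_⟩
      cases l with
      | nil => simp at h3
      | cons => simp)
    omega
  | succ n ih =>
    intro S G hI hS
    by_cases hd : ∃ v ∈ S, ∃ b l, (b :: l).Nodup ∧ (∀ x, x ∈ b :: l ↔ G.Adj v x) ∧
        (b :: (l ++ [b])).IsChain G.Adj ∧ l.length ≤ 4
    · obtain ⟨v, hv, b, l, h1, h2, h3, h4⟩ := hd
      have h5 : 2 ≤ l.length := by
        match l with
        | [] => simp at h3
        | [c] =>
          have hbc : G.Adj b c := by simp at h3; exact h3.1
          have := triangle hI hv (a := b) (b := c) (fun z => by rw [← h2]; simp) hbc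
          omega
        | _ :: _ :: _ => simp
      obtain ⟨d, f, R, hf, hfv, hR, hloc⟩ := loc_of_ham h1 h2 h3 h5 h4
      obtain ⟨L, hL, hI'⟩ := red_inv hI (by omega) v hv f hf hfv R hR hloc
      have := ih _ _ hI' (by rw [Finset.card_erase_of_mem hv]; omega)
      have := red_edges G v f hf hfv L hL
      omega
    · have := edges_of_degree (S := S) (G := G) 6 (by
        intro v hv
        obtain ⟨b, l, h1, h2, h3⟩ := hI.ham v hv
        refine ⟨b :: l, h1, h2, ?_⟩
        by_contra hlt
        exact hd ⟨v, hv, b, l, h1, h2, h3, by simp at hlt; omega⟩)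
      omega

theorem inv_of [Fintype V] [DecidableEq V] (G : SimpleGraph V) [DecidableRel G.Adj]
    (hconn : G.Connected) (hlh : G.LocallyHamiltonian)
    (hn : 3 ≤ Fintype.card V) : Inv Finset.univ G := by
  have hcl : ∀ P : V → Prop, (∃ s ∈ (Finset.univ : Finset V), P s) →
      (∀ x y, G.Adj x y → P x → P y) → ∀ s ∈ (Finset.univ : Finset V), P s := by
    rintro P ⟨s, -, hs⟩ hP t -
    obtain ⟨w⟩ := hconn.preconnected s t
    induction w with
    | nil => exact hs
    | cons h _ ih => exact ih (hP _ _ h hs)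
  have hrot : ∀ {d : ℕ} (i : Fin d), 2 ≤ d → finRotate d i ≠ i := by
    intro d i hd h
    obtain ⟨d, rfl⟩ : ∃ e, d = e + 2 := ⟨d - 2, by omega⟩
    simp at h
  -- degrees are at least two
  have hdeg : ∀ v, 2 ≤ G.degree v := by
    intro v
    by_contra hlt
    have h0 : ∃ w, ∀ z, G.Adj v z → z = w := by
      have : (G.neighborFinset v).card ≤ 1 := by
        rw [G.card_neighborFinset_eq_degree]; omega
      rw [Finset.card_le_one] at this
      by_cases h : ∃ w, G.Adj v w
      · obtain ⟨w, hw⟩ := h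
        exact ⟨w, fun z hz => this z (by simpa) w (by simpa)⟩
      · exact ⟨v, fun z hz => absurd ⟨z, hz⟩ h⟩
    obtain ⟨w, hw⟩ := h0
    have hwv : ∀ z, G.Adj w z → z = v ∨ z = w := by
      intro z hz
      by_contra hzz
      push Not at hzz
      by_cases hvw : G.Adj w v
      · obtain ⟨e, he⟩ := hlh w
        have hd : 2 ≤ G.degree w := by
          rw [← G.card_neighborFinset_eq_degree]
          exact Finset.one_lt_card.2 ⟨z, by simpa, v, by simpa, hzz.1⟩
        obtain ⟨i, hi⟩ := e.surjective ⟨v, by simpa⟩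
        have hne : (e i : V) ≠ e (finRotate _ i) := by
          intro h
          exact hrot i hd (e.injective (Subtype.ext h)).symm
        have h1 := he i hne
        rw [hi] at h1
        have h2 := hw _ h1
        have h3 := (e (finRotate _ i)).2
        rw [h2] at h3
        simp at h3
      · have := hcl (fun t => t = v) ⟨v, by simp, rfl⟩ (by
          rintro x y hxy rfl
          have := hw y hxy
          subst this
          exact absurd hxy.symm hvw) z (by simp)
        exact hzz.1 this
    have hsub : (Finset.univ : Finset V) ⊆ {v, w} := by
      intro s hs
      have := hcl (fun z => z = v ∨ z = w) ⟨v, by simp, Or.inl rfl⟩ (by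
        rintro x y hxy (rfl | rfl)
        · exact Or.inr (hw y hxy)
        · exact hwv y hxy) s hs
      simpa using this
    have := (Finset.card_le_card hsub).trans Finset.card_le_two
    rw [Finset.card_univ] at this
    omega
  refine ⟨fun _ _ _ => Finset.mem_univ _, hcl, ?_⟩
  intro v _
  have hd := hdeg v
  obtain ⟨e, he⟩ := hlh v
  have hm : ∀ x, G.Adj v x ↔ ∃ i, (e i : V) = x := by
    intro x
    constructor
    · intro h
      obtain ⟨i, hi⟩ := e.surjective ⟨x, by simpa⟩
      exact ⟨i, by rw [hi]⟩
    · rintro ⟨i, rfl⟩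
      exact (G.mem_neighborFinset v _).1 (e i).2
  have hadj : ∀ i, G.Adj (e i) (e (finRotate _ i)) := fun i =>
    he i fun h => hrot i hd (e.injective (Subtype.ext h)).symm
  have hinj : Function.Injective fun i => (e i : V) := fun i j h => e.injective (Subtype.ext h)
  generalize hg : (fun i => (e i : V)) = g at *
  have hg' : ∀ i, (e i : V) = g i := fun i => congrFun hg i
  simp only [hg'] at hm hadj
  clear he hg hg' e
  generalize G.degree v = d at *
  obtain ⟨d, rfl⟩ : ∃ e, d = e + 1 := ⟨d - 1, by omega⟩
  have hcons : List.ofFn g = g 0 :: List.ofFn (fun i : Fin d => g i.succ) := List.ofFn_succ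
  refine ⟨g 0, List.ofFn (fun i : Fin d => g i.succ), ?_, ?_, ?_⟩
  · rw [← hcons]; exact List.nodup_ofFn.2 hinj
  · intro x
    rw [← hcons, hm, List.mem_ofFn]
  · rw [← List.cons_append, ← hcons, List.isChain_iff_getElem]
    intro i hi
    simp at hi
    have h := hadj ⟨i, by omega⟩
    rw [List.getElem_append_left (by simpa using hi)]
    rw [List.getElem_ofFn]
    by_cases hid : i < d
    · rw [List.getElem_append_left (by simpa using hid), List.getElem_ofFn]
      rwa [finRotate_of_lt hid] at h
    · have : i = d := by omega
      subst this
      rw [List.getElem_append_right (by simp)]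
      rw [finRotate_last'] at h
      simpa using h

end LH

/-- If `G` is a connected, locally Hamiltonian simple graph on `n ≥ 3` vertices with at
most `3n − 6` edges, then `G` has exactly `3n − 6` edges. -/
theorem locallyHamiltonian_card_edges_eq_of_le
    {V : Type*} [Fintype V] [DecidableEq V] (G : SimpleGraph V) [DecidableRel G.Adj]
    (hconn : G.Connected) (hlh : G.LocallyHamiltonian)
    (hn : 3 ≤ Fintype.card V)
    (hle : G.edgeFinset.card ≤ 3 * Fintype.card V - 6) :
    G.edgeFinset.card = 3 * Fintype.card V - 6 := by
  have h := LH.main (Fintype.card V - 3) Finset.univ G (LH.inv_of G hconn hlh hn)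
    (by rw [Finset.card_univ]; omega)
  rw [Set.ncard_eq_toFinset_card' G.edgeSet] at h
  have e : G.edgeSet.toFinset = G.edgeFinset := rfl
  rw [e] at h
  omega
end
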